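/- arXiv:1101.0129 — 2 statements merged into one kernel-verified Lean document; each statement's English description precedes it below -/
import Mathlib

section
/- (Pfaffian kernel theorem.) Let Θ and Ξ be n×n skew-symmetric matrices over a commutative ring with n even. Let Θ̃ be the skew-symmetric matrix with entries θ̃_{ij} = (−1)^{i+j+1} θ_{ij} (the checkerboard sign flip which flips the signs along the pattern containing the diagonal). Then ∑_{J ⊆ {1,…,n}} Pf(Θ_{Jᶜ}) · Pf(Ξ_J) = Pf(Θ̃ + Ξ), where Jᶜ = {1,…,n} ∖ J. Equivalently, the total contraction ⟨sPf^∨(Θ), sPf(Ξ)⟩ equals Pf(Θ̃ + Ξ). -/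
/-- The subPfaffian of a skew-symmetric matrix, defined by recursive expansion
along the row of the minimal index of `I`; `pf M I` is the Pfaffian of the principal
submatrix of `M` on the index set `I`.  It is `1` for `I = ∅` and `0` for `|I|` odd. -/
def pf {R : Type*} [CommRing R] (M : ℕ → ℕ → R) (I : Finset ℕ) : R :=
  if h : I.Nonempty then
    ∑ j ∈ I.erase (I.min' h),
      (-1 : R) ^ ((I.filter (fun t => t < j)).card + 1) * M (I.min' h) j *
        pf M ((I.erase (I.min' h)).erase j)
  else 1
termination_by I.card
decreasing_by
  exact lt_of_le_of_lt (Finset.card_le_card (Finset.erase_subset _ _))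
    (Finset.card_erase_lt_of_mem (I.min'_mem h))


open Finset in
theorem pf_insert {R : Type*} [CommRing R] (M : ℕ → ℕ → R) (m : ℕ) (I : Finset ℕ)
    (hm : ∀ x ∈ I, m < x) :
    pf M (insert m I) = ∑ j ∈ I, (-1 : R) ^ (I.filter (fun t => t < j)).card * M m j *
      pf M (I.erase j) := by
  have hmI : m ∉ I := fun h => lt_irrefl _ (hm m h)
  have hne : (insert m I).Nonempty := insert_nonempty _ _
  have hmin : (insert m I).min' hne = m := by
    apply le_antisymm
    · exact min'_le _ _ (mem_insert_self _ _)
    · apply le_min'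
      intro y hy
      rcases mem_insert.1 hy with h | h
      · exact h.ge
      · exact (hm y h).le
  rw [pf, dif_pos hne]
  simp only [hmin, erase_insert hmI]
  refine sum_congr rfl fun j hj => ?_
  rw [filter_insert, if_pos (hm j hj), card_insert_of_notMem (by simp [hmI]), pow_add, pow_add]
  ring

theorem pf_empty {R : Type*} [CommRing R] (M : ℕ → ℕ → R) : pf M ∅ = 1 := by
  rw [pf]; simp

open Finset in
theorem eq_insert_min (I : Finset ℕ) (h : I.Nonempty) :
    ∃ m I', (∀ x ∈ I', m < x) ∧ I = insert m I' := by
  refine ⟨I.min' h, I.erase (I.min' h), fun x hx => ?_, (insert_erase (I.min'_mem h)).symm⟩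
  exact I.min'_lt_of_mem_erase_min' h hx

open Finset in
theorem pf_odd {R : Type*} [CommRing R] (M : ℕ → ℕ → R) (k : ℕ) :
    ∀ I : Finset ℕ, I.card = 2 * k + 1 → pf M I = 0 := by
  induction k with
  | zero =>
    intro I hI
    obtain ⟨a, rfl⟩ := card_eq_one.1 hI
    have := pf_insert M a ∅ (by simp)
    simpa using this
  | succ k ih =>
    intro I hI
    obtain ⟨m, I', hm, rfl⟩ := eq_insert_min I (card_pos.1 (by omega))
    have hmI : m ∉ I' := fun h => lt_irrefl _ (hm m h)
    rw [card_insert_of_notMem hmI] at hI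
    rw [pf_insert M m I' hm]
    refine sum_eq_zero fun j hj => ?_
    rw [ih _ (by rw [card_erase_of_mem hj]; omega), mul_zero]

/-- exponent of the sign attached to a splitting -/
def pfExp (K J : Finset ℕ) : ℕ :=
  ∑ a ∈ K, (a + (J.filter (fun t => t < a)).card) + K.card / 2

open Finset in
theorem pfExp_left (K J : Finset ℕ) (m j : ℕ) (hmK : m ∉ K) (hjK : j ∉ K) (hmj : m < j)
    (hJ : ∀ x ∈ J, m < x) :
    pfExp (insert m (insert j K)) J
      = pfExp K J + m + j + 1 + (J.filter (fun t => t < j)).card := by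
  unfold pfExp
  have h1 : m ∉ insert j K := by simp [hmK, hmj.ne]
  rw [sum_insert h1, sum_insert hjK, card_insert_of_notMem h1, card_insert_of_notMem hjK]
  have : J.filter (fun t => t < m) = ∅ := by
    apply filter_eq_empty_iff.2
    intro x hx
    exact not_lt.2 (hJ x hx).le
  rw [this, card_empty]
  omega

open Finset in
theorem pfExp_right (K J : Finset ℕ) (m j : ℕ) (hjK : j ∉ K) (hmJ : m ∉ J) (hjJ : j ∉ J)
    (hmj : m < j) (hK : ∀ x ∈ K, m < x) :
    pfExp K (insert m (insert j J)) + (K.filter (fun t => t < j)).card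
      = pfExp K J + 2 * K.card := by
  unfold pfExp
  have h1 : m ∉ insert j J := by simp [hmJ, hmj.ne]
  have h2 : ∀ a ∈ K, (a + ((insert m (insert j J)).filter (fun t => t < a)).card)
      + (if a < j then 1 else 0)
      = (a + (J.filter (fun t => t < a)).card) + 2 := by
    intro a ha
    have haj : a ≠ j := fun h => hjK (h ▸ ha)
    rw [filter_insert, if_pos (hK a ha), card_insert_of_notMem (by simp [hmJ, hmj.ne]),
      filter_insert]
    split_ifs with h3 h4 h4
    · omega
    · rw [card_insert_of_notMem (by simp [hjJ])]; omega
    · omega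
    · omega
  have h3 := sum_congr (rfl : K = K) h2
  simp only [sum_add_distrib, ← card_filter, sum_const, smul_eq_mul] at h3 ⊢
  omega

open Finset in
theorem sum_pow_insert {R : Type*} [CommRing R] (S : Finset ℕ) (f : ℕ → Finset ℕ → R) :
    ∑ J ∈ S.powerset, ∑ j ∈ J, f j J
      = ∑ j ∈ S, ∑ J ∈ (S.erase j).powerset, f j (insert j J) := by
  rw [sum_sigma', sum_sigma']
  refine sum_bij' (fun p _ => ⟨p.2, p.1.erase p.2⟩) (fun p _ => ⟨insert p.1 p.2, p.1⟩)
    ?_ ?_ ?_ ?_ ?_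
  · rintro ⟨J, j⟩ h
    simp only [mem_sigma, mem_powerset] at h ⊢
    exact ⟨h.1 h.2, erase_subset_erase _ h.1⟩
  · rintro ⟨j, J⟩ h
    simp only [mem_sigma, mem_powerset] at h ⊢
    exact ⟨insert_subset h.1 (h.2.trans (erase_subset _ _)), mem_insert_self _ _⟩
  · rintro ⟨J, j⟩ h
    simp only [mem_sigma, mem_powerset] at h ⊢
    simp [insert_erase h.2]
  · rintro ⟨j, J⟩ h
    simp only [mem_sigma, mem_powerset] at h ⊢
    have : j ∉ J := fun h' => by simpa using h.2 h'
    simp [erase_insert this]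
  · rintro ⟨J, j⟩ h
    simp only [mem_sigma, mem_powerset] at h ⊢
    simp [insert_erase h.2]

open Finset in
theorem sum_pow_sdiff {R : Type*} [CommRing R] (S : Finset ℕ) (f : ℕ → Finset ℕ → R) :
    ∑ J ∈ S.powerset, ∑ j ∈ S \ J, f j J
      = ∑ j ∈ S, ∑ J ∈ (S.erase j).powerset, f j J := by
  refine sum_comm' fun J j => ?_
  simp only [mem_powerset, mem_sdiff, subset_erase]
  tauto

open Finset in
theorem card_filter_split (S J : Finset ℕ) (h : J ⊆ S) (j : ℕ) :
    (S.filter (fun t => t < j)).card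
      = ((S \ J).filter (fun t => t < j)).card + (J.filter (fun t => t < j)).card := by
  rw [← card_union_of_disjoint, ← filter_union, sdiff_union_of_subset h]
  exact disjoint_filter_filter sdiff_disjoint

theorem neg_one_pow_eq {R : Type*} [CommRing R] {a b : ℕ} (h : a % 2 = b % 2) :
    (-1 : R) ^ a = (-1) ^ b := by
  rw [neg_one_pow_eq_pow_mod_two, h, ← neg_one_pow_eq_pow_mod_two]

open Finset in
theorem pf_add {R : Type*} [CommRing R] (Θ Ξ : ℕ → ℕ → R) (N : ℕ) :
    ∀ I : Finset ℕ, I.card = N →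
    pf (fun i j => (-1 : R) ^ (i + j + 1) * Θ i j + Ξ i j) I
      = ∑ J ∈ I.powerset, (-1 : R) ^ pfExp (I \ J) J * (pf Θ (I \ J) * pf Ξ J) := by
  induction N using Nat.strong_induction_on with
  | _ N ih =>
  intro I hI
  rcases I.eq_empty_or_nonempty with rfl | hne
  · simp [pf_empty, pfExp]
  obtain ⟨m, S, hm, rfl⟩ := eq_insert_min I hne
  have hmS : m ∉ S := fun h => lt_irrefl _ (hm m h)
  rw [card_insert_of_notMem hmS] at hI
  rw [sum_powerset_insert hmS, pf_insert _ m S hm]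
  have e1 : ∑ J ∈ S.powerset, (-1 : R) ^ pfExp (insert m S \ J) J *
        (pf Θ (insert m S \ J) * pf Ξ J)
      = ∑ j ∈ S, ∑ J ∈ (S.erase j).powerset,
        (-1 : R) ^ (S.filter (fun t => t < j)).card * ((-1 : R) ^ (m + j + 1) * Θ m j) *
        ((-1 : R) ^ pfExp (S.erase j \ J) J * (pf Θ (S.erase j \ J) * pf Ξ J)) := by
    rw [← sum_pow_sdiff S (fun j J =>
        (-1 : R) ^ (S.filter (fun t => t < j)).card * ((-1 : R) ^ (m + j + 1) * Θ m j) *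
        ((-1 : R) ^ pfExp (S.erase j \ J) J * (pf Θ (S.erase j \ J) * pf Ξ J)))]
    refine sum_congr rfl fun J hJ => ?_
    have hJ := mem_powerset.1 hJ
    rw [insert_sdiff_of_notMem _ (fun h => hmS (hJ h)),
      pf_insert Θ m (S \ J) (fun x hx => hm x (mem_sdiff.1 hx).1), sum_mul, mul_sum]
    refine sum_congr rfl fun j hj => ?_
    have hjS := (mem_sdiff.1 hj).1
    have h1 : S.erase j \ J = (S \ J).erase j := erase_sdiff_comm _ _ _
    have h2 := pfExp_left ((S \ J).erase j) J m j (by simp [hmS]) (by simp) (hm j hjS)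
      (fun x hx => hm x (hJ hx))
    rw [insert_erase hj] at h2
    have h3 := card_filter_split S J hJ j
    rw [h1]
    have h4 : (-1 : R) ^ (pfExp (insert m (S \ J)) J + ((S \ J).filter (fun t => t < j)).card)
      = (-1) ^ ((S.filter (fun t => t < j)).card + (m + j + 1) + pfExp ((S \ J).erase j) J) := by
      apply neg_one_pow_eq; omega
    rw [pow_add, pow_add, pow_add _ (#_)] at h4
    linear_combination (Θ m j * pf Θ ((S \ J).erase j) * pf Ξ J) * h4
  have e2 : ∑ J ∈ S.powerset, (-1 : R) ^ pfExp (insert m S \ insert m J) (insert m J) *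
        (pf Θ (insert m S \ insert m J) * pf Ξ (insert m J))
      = ∑ j ∈ S, ∑ J ∈ (S.erase j).powerset,
        (-1 : R) ^ (S.filter (fun t => t < j)).card * Ξ m j *
        ((-1 : R) ^ pfExp (S.erase j \ J) J * (pf Θ (S.erase j \ J) * pf Ξ J)) := by
    have : ∀ J ∈ S.powerset, (-1 : R) ^ pfExp (insert m S \ insert m J) (insert m J) *
        (pf Θ (insert m S \ insert m J) * pf Ξ (insert m J)) =
        ∑ j ∈ J, (-1 : R) ^ pfExp (S \ J) (insert m J) * (pf Θ (S \ J) *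
          ((-1 : R) ^ (J.filter (fun t => t < j)).card * Ξ m j * pf Ξ (J.erase j))) := by
      intro J hJ
      have hJ := mem_powerset.1 hJ
      have : insert m S \ insert m J = S \ J := by
        ext x; simp only [mem_sdiff, mem_insert]
        constructor
        · tauto
        · rintro ⟨h1, h2⟩
          exact ⟨Or.inr h1, fun h => h.elim (fun h => hmS (h ▸ h1)) h2⟩
      rw [this, pf_insert Ξ m J (fun x hx => hm x (hJ hx)), mul_sum, mul_sum]
    rw [sum_congr rfl this, sum_pow_insert S (fun j J =>
      (-1 : R) ^ pfExp (S \ J) (insert m J) * (pf Θ (S \ J) *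
          ((-1 : R) ^ (J.filter (fun t => t < j)).card * Ξ m j * pf Ξ (J.erase j))))]
    refine sum_congr rfl fun j hj => sum_congr rfl fun J hJ => ?_
    have hJ := mem_powerset.1 hJ
    have hjJ : j ∉ J := fun h => by simpa using hJ h
    have hJS : insert j J ⊆ S := insert_subset hj (hJ.trans (erase_subset _ _))
    have h1 : S.erase j \ J = S \ insert j J := by
      ext x; simp only [mem_sdiff, mem_insert, mem_erase]; tauto
    have h2 := pfExp_right (S \ insert j J) J m j (by simp)
      (fun h => hmS (hJS (mem_insert_of_mem h))) hjJ (hm j hj)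
      (fun x hx => hm x (mem_sdiff.1 hx).1)
    have h3 := card_filter_split S _ hJS j
    rw [h1, erase_insert hjJ]
    have h4 : (-1 : R) ^ (pfExp (S \ insert j J) (insert m (insert j J)) +
        ((insert j J).filter (fun t => t < j)).card)
      = (-1) ^ ((S.filter (fun t => t < j)).card + pfExp (S \ insert j J) J) := by
      apply neg_one_pow_eq; omega
    rw [pow_add, pow_add] at h4
    linear_combination (Ξ m j * pf Θ (S \ insert j J) * pf Ξ J) * h4
  rw [e1, e2, ← sum_add_distrib]
  refine sum_congr rfl fun j hj => ?_
  rw [ih (S.erase j).card (by rw [card_erase_of_mem hj]; omega) _ rfl, mul_sum,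
    ← sum_add_distrib]
  refine sum_congr rfl fun J _ => ?_
  ring

open Finset in
theorem sum_card_lt (K : Finset ℕ) :
    2 * ∑ a ∈ K, (K.filter (fun t => t < a)).card + K.card = K.card * K.card := by
  induction K using Finset.induction_on_max with
  | empty => simp
  | insert a K h ih =>
    have haK : a ∉ K := fun h' => lt_irrefl _ (h a h')
    have h1 : (insert a K).filter (fun t => t < a) = K := by
      ext x; simp only [mem_filter, mem_insert]
      constructor
      · rintro ⟨rfl | h1, h2⟩
        · exact absurd h2 (lt_irrefl _)
        · exact h1
      · exact fun hx => ⟨Or.inr hx, h x hx⟩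
    have h2 : ∀ x ∈ K, ((insert a K).filter (fun t => t < x)).card
        = (K.filter (fun t => t < x)).card := by
      intro x hx
      rw [filter_insert, if_neg (not_lt.2 (h x hx).le)]
    rw [sum_insert haK, h1, sum_congr rfl h2, card_insert_of_notMem haK]
    linarith

open Finset in
theorem pfExp_even (n : ℕ) (J : Finset ℕ) (hJ : J ⊆ Icc 1 n) (p : ℕ)
    (hp : (Icc 1 n \ J).card = 2 * p) : pfExp (Icc 1 n \ J) J % 2 = 0 := by
  have h1 := sum_card_lt (Icc 1 n \ J)
  have h2 : ∑ a ∈ Icc 1 n \ J, ((a + (J.filter (fun t => t < a)).card) +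
      ((Icc 1 n \ J).filter (fun t => t < a)).card + 1) = ∑ a ∈ Icc 1 n \ J, 2 * a := by
    refine sum_congr rfl fun a ha => ?_
    have h3 := card_filter_split (Icc 1 n) J hJ a
    have h4 := mem_Icc.1 (mem_sdiff.1 ha).1
    have h5 : (Icc 1 n).filter (fun t => t < a) = Ico 1 a := by
      ext x; simp only [mem_filter, mem_Icc, mem_Ico]; omega
    rw [h5, Nat.card_Ico] at h3
    omega
  rw [sum_add_distrib, sum_add_distrib, ← mul_sum, sum_const, smul_eq_mul, hp] at h2
  rw [hp] at h1
  unfold pfExp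
  rw [hp]
  have h6 : ∑ a ∈ Icc 1 n \ J, ((Icc 1 n \ J).filter (fun t => t < a)).card + p
      = 2 * (p * p) := by linarith
  omega

/-- Pfaffian kernel theorem: for `n` even and skew-symmetric `Θ, Ξ` with indices
`{1,…,n}`, `∑_{J ⊆ {1,…,n}} Pf(Θ_{Jᶜ}) · Pf(Ξ_J) = Pf(Θ̃ + Ξ)`, where
`θ̃ᵢⱼ = (−1)^{i+j+1} θᵢⱼ` is the checkerboard sign flip. -/
theorem pfaffian_kernel {R : Type*} [CommRing R] (n : ℕ) (hn : Even n)
    (Θ Ξ : ℕ → ℕ → R)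
    (hΘ : ∀ i j, Θ j i = - Θ i j) (hΞ : ∀ i j, Ξ j i = - Ξ i j) :
    ∑ J ∈ (Finset.Icc 1 n).powerset, pf Θ (Finset.Icc 1 n \ J) * pf Ξ J
      = pf (fun i j => (-1 : R) ^ (i + j + 1) * Θ i j + Ξ i j) (Finset.Icc 1 n) := by
  rw [pf_add Θ Ξ _ _ rfl]
  refine Finset.sum_congr rfl fun J hJ => ?_
  have hJ := Finset.mem_powerset.1 hJ
  rcases Nat.even_or_odd' (Finset.Icc 1 n \ J).card with ⟨p, hp | hp⟩
  · rw [neg_one_pow_eq (b := 0) (pfExp_even n J hJ p hp), pow_zero, one_mul]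
  · rw [pf_odd Θ p _ hp]; simp
end

section
/- (All symmetric arity-three signatures are Pfaffian after homogeneous basis change.) Let T be a nonzero tensor in (ℂ²)^{⊗3} that is invariant under all permutations of the three tensor factors. Then there exists an invertible matrix A ∈ GL₂(ℂ) such that (A ⊗ A ⊗ A)T is supported entirely on the even-weight standard basis vectors |000⟩, |011⟩, |101⟩, |110⟩, or entirely on the odd-weight standard basis vectors |001⟩, |010⟩, |100⟩, |111⟩. -/
/-- The symmetric trilinear form with coefficients a, b, c, d. -/
def triF (a b c d u0 u1 v0 v1 w0 w1 : ℂ) : ℂ :=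
  a * (u0 * v0 * w0) + b * (u1 * v0 * w0 + u0 * v1 * w0 + u0 * v0 * w1)
    + c * (u1 * v1 * w0 + u1 * v0 * w1 + u0 * v1 * w1) + d * (u1 * v1 * w1)

lemma triF_step (a b c d q0 q1 r0 r1 : ℂ) (hdet : r0 * q1 - r1 * q0 ≠ 0)
    (hq : triF a b c d q0 q1 q0 q1 q0 q1 = 0) :
    ∃ p0 p1 s0 s1 : ℂ, p0 * s1 - p1 * s0 ≠ 0 ∧
      triF a b c d p0 p1 p0 p1 s0 s1 = 0 ∧ triF a b c d s0 s1 s0 s1 s0 s1 = 0 := by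
  by_cases h1 : triF a b c d q0 q1 q0 q1 r0 r1 = 0
  · by_cases h2 : triF a b c d r0 r1 r0 r1 q0 q1 = 0
    · exact ⟨r0, r1, q0, q1, hdet, h2, hq⟩
    · obtain ⟨s, hs⟩ : ∃ s : ℂ, triF a b c d r0 r1 r0 r1 r0 r1
          + 3 * s * triF a b c d r0 r1 r0 r1 q0 q1 = 0 :=
        ⟨-triF a b c d r0 r1 r0 r1 r0 r1 / (3 * triF a b c d r0 r1 r0 r1 q0 q1), by
          field_simp; ring⟩
      refine ⟨q0, q1, r0 + s * q0, r1 + s * q1, ?_, ?_, ?_⟩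
      · intro h; apply hdet; linear_combination -h
      · unfold triF at *
        linear_combination h1 + s * hq
      · unfold triF at *
        linear_combination hs + 3 * s ^ 2 * h1 + s ^ 3 * hq
  · obtain ⟨s, hs⟩ : ∃ s : ℂ, triF a b c d r0 r1 r0 r1 q0 q1
          + 2 * s * triF a b c d q0 q1 q0 q1 r0 r1 = 0 :=
        ⟨-triF a b c d r0 r1 r0 r1 q0 q1 / (2 * triF a b c d q0 q1 q0 q1 r0 r1), by
          field_simp; ring⟩
    refine ⟨r0 + s * q0, r1 + s * q1, q0, q1, ?_, ?_, hq⟩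
    · intro h; apply hdet; linear_combination h
    · unfold triF at *
      linear_combination hs + s ^ 2 * hq

lemma triF_exists (a b c d : ℂ) :
    ∃ p0 p1 s0 s1 : ℂ, p0 * s1 - p1 * s0 ≠ 0 ∧
      triF a b c d p0 p1 p0 p1 s0 s1 = 0 ∧ triF a b c d s0 s1 s0 s1 s0 s1 = 0 := by
  by_cases hd : d = 0
  · exact triF_step a b c d 0 1 1 0 (by norm_num) (by simp [triF, hd])
  · obtain ⟨t, ht⟩ := IsAlgClosed.exists_root
      (Polynomial.C d * Polynomial.X ^ 3 + Polynomial.C (3 * c) * Polynomial.X ^ 2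
        + Polynomial.C (3 * b) * Polynomial.X + Polynomial.C a)
      (by rw [Polynomial.degree_cubic hd]; norm_num)
    refine triF_step a b c d 1 t 0 1 (by norm_num) ?_
    simp [Polynomial.IsRoot] at ht
    unfold triF
    linear_combination ht

lemma sum_bits3 (f : (Fin 3 → Fin 2) → ℂ) :
    ∑ y, f y = f ![0,0,0] + f ![0,0,1] + f ![0,1,0] + f ![0,1,1]
      + f ![1,0,0] + f ![1,0,1] + f ![1,1,0] + f ![1,1,1] := by
  have : (Finset.univ : Finset (Fin 3 → Fin 2)) =
    {![0,0,0], ![0,0,1], ![0,1,0], ![0,1,1], ![1,0,0], ![1,0,1], ![1,1,0], ![1,1,1]} := by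
    decide
  rw [this]
  repeat rw [Finset.sum_insert (by decide)]
  rw [Finset.sum_singleton]
  ring


/-- The weight of a bitstring: its number of ones. -/
def wt {n : ℕ} (x : Fin n → Fin 2) : ℕ :=
  (Finset.univ.filter (fun i => x i = 1)).card

/-- The homogeneous basis-change action of a matrix `A` on a tensor in `(ℂ²)^{⊗3}`,
written on coefficient functions: `(A ⊗ A ⊗ A)T (x) = ∑_y (∏ᵢ A_{xᵢ yᵢ}) T(y)`. -/
noncomputable def cob3 (A : Matrix (Fin 2) (Fin 2) ℂ)
    (T : (Fin 3 → Fin 2) → ℂ) : (Fin 3 → Fin 2) → ℂ :=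
  fun x => ∑ y : Fin 3 → Fin 2, (∏ i, A (x i) (y i)) * T y

/-- Every nonzero symmetric tensor in `(ℂ²)^{⊗3}` can be put, by a homogeneous
basis change `A ⊗ A ⊗ A` with `A ∈ GL₂(ℂ)`, into a tensor supported entirely on
the even-weight basis vectors or entirely on the odd-weight basis vectors. -/
theorem symmetric_arity_three_pure_parity (T : (Fin 3 → Fin 2) → ℂ)
    (hT : T ≠ 0)
    (hsym : ∀ σ : Equiv.Perm (Fin 3), ∀ x : Fin 3 → Fin 2, T (x ∘ σ) = T x) :
    ∃ A : GL (Fin 2) ℂ,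
      (∀ x : Fin 3 → Fin 2, Odd (wt x) →
          cob3 (A : Matrix (Fin 2) (Fin 2) ℂ) T x = 0) ∨
      (∀ x : Fin 3 → Fin 2, Even (wt x) →
          cob3 (A : Matrix (Fin 2) (Fin 2) ℂ) T x = 0) := by
  have e1 : T ![0,1,0] = T ![0,0,1] := by
    rw [← hsym (Equiv.swap 1 2) ![0,0,1]]; congr 1; decide
  have e2 : T ![1,0,0] = T ![0,0,1] := by
    rw [← hsym (Equiv.swap 0 2) ![0,0,1]]; congr 1; decide
  have e3 : T ![1,0,1] = T ![0,1,1] := by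
    rw [← hsym (Equiv.swap 0 1) ![0,1,1]]; congr 1; decide
  have e4 : T ![1,1,0] = T ![0,1,1] := by
    rw [← hsym (Equiv.swap 0 2) ![0,1,1]]; congr 1; decide
  obtain ⟨p0, p1, s0, s1, hdet, h1, h2⟩ :=
    triF_exists (T ![0,0,0]) (T ![0,0,1]) (T ![0,1,1]) (T ![1,1,1])
  refine ⟨Matrix.GeneralLinearGroup.mkOfDetNeZero !![p0, p1; s0, s1]
    (by rw [Matrix.det_fin_two_of]; exact hdet), Or.inl ?_⟩
  have key : ∀ x : Fin 3 → Fin 2, Odd (wt x) →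
      x = ![0,0,1] ∨ x = ![0,1,0] ∨ x = ![1,0,0] ∨ x = ![1,1,1] := by
    unfold wt; decide
  intro x hx
  unfold triF at h1 h2
  rcases key x hx with rfl | rfl | rfl | rfl <;>
    simp [cob3, sum_bits3, Fin.prod_univ_three, Matrix.GeneralLinearGroup.mkOfDetNeZero,
      e1, e2, e3, e4]
  · linear_combination h1
  · linear_combination h1
  · linear_combination h1
  · linear_combination h2
end
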